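/- Let z ∈ (-1,0] be a real number and s_1,...,s_k positive integers (k ≥ 1). Then ∑_{n=1}^∞ ζ_n(s_1,...,s_k; z) / ((n+z)(n+1+z)) = ζ(s_1,...,s_{k-1}, s_k + 1; z). -/

import Mathlib

open scoped BigOperators Classical

/-- The finite multiple Hurwitz zeta value
`ζ_n(s_1,…,s_k; z) = ∑_{1 ≤ n_1 < ⋯ < n_k ≤ n} ∏ 1/(n_i+z)^{s_i}`. -/
noncomputable def finMZV (z : ℝ) {k : ℕ} (s : Fin k → ℕ) (n : ℕ) : ℝ :=
  ∑ t : Fin k → Fin n, if StrictMono t then ∏ i, 1 / (((t i : ℕ) : ℝ) + 1 + z) ^ (s i) else 0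

/-- The multiple Hurwitz zeta value
`ζ(s_1,…,s_k; z) = ∑_{1 ≤ n_1 < ⋯ < n_k} ∏ 1/(n_i+z)^{s_i}`. -/
noncomputable def MZV (z : ℝ) {k : ℕ} (s : Fin k → ℕ) : ℝ :=
  ∑' f : {f : Fin k → ℕ // StrictMono f}, ∏ i, 1 / ((f.1 i : ℝ) + 1 + z) ^ (s i)

theorem Real.tsum_eq_toReal_tsum_ofReal {α : Type*} {f : α → ℝ} (hf : ∀ a, 0 ≤ f a) :
    ∑' a, f a = (∑' a, ENNReal.ofReal (f a)).toReal := by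
  rw [ENNReal.tsum_toReal_eq fun _ ↦ ENNReal.ofReal_ne_top]
  exact tsum_congr fun a ↦ (ENNReal.toReal_ofReal (hf a)).symm

theorem hasSum_one_div_mul_succ {x : ℝ} (hx : 0 < x) :
    HasSum (fun n : ℕ ↦ 1 / ((n + x) * (n + x + 1))) (1 / x) := by
  rw [hasSum_iff_tendsto_nat_of_nonneg (fun n ↦ by positivity)]
  have partial_sum (N : ℕ) :
      ∑ n ∈ Finset.range N, 1 / ((n + x) * (n + x + 1)) = 1 / x - 1 / ((N : ℝ) + x) := by
    induction N with
    | zero => simp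
    | succ N ih =>
      rw [Finset.sum_range_succ, ih]
      have : (N : ℝ) + x ≠ 0 := by positivity
      have : (N : ℝ) + x + 1 ≠ 0 := by positivity
      have : (N : ℝ) + 1 + x ≠ 0 := by positivity
      push_cast
      field_simp
      ring
  simp only [partial_sum]
  have hlim : Filter.Tendsto (fun N : ℕ ↦ 1 / ((N : ℝ) + x)) Filter.atTop (nhds 0) := by
    simp only [one_div]
    exact tendsto_inv_atTop_zero.comp
      (Filter.tendsto_atTop_add_const_right _ x tendsto_natCast_atTop_atTop)
  simpa using hlim.const_sub (1 / x)

theorem hasSum_ite_le_one_div_mul_succ {z : ℝ} (hz : -1 < z) (m : ℕ) :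
    HasSum (fun n : ℕ ↦ if m ≤ n then 1 / (((n : ℝ) + 1 + z) * ((n : ℝ) + 2 + z)) else 0)
      (1 / ((m : ℝ) + 1 + z)) := by
  have hm : 0 < (m : ℝ) + 1 + z := by linarith [(m.cast_nonneg : (0 : ℝ) ≤ m)]
  rw [← (add_left_injective m).hasSum_iff]
  · convert hasSum_one_div_mul_succ hm using 2 with n
    simp only [Function.comp_apply, le_add_iff_nonneg_left, zero_le, if_true]
    push_cast
    ring_nf
  · intro n hn
    exact if_neg fun h ↦ hn ⟨n - m, Nat.sub_add_cancel h⟩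

theorem one_div_mul_succ_nonneg {z : ℝ} (hz : -1 < z) (n : ℕ) :
    0 ≤ 1 / (((n : ℝ) + 1 + z) * ((n : ℝ) + 2 + z)) := by
  have : 0 < (n : ℝ) + 1 + z := by linarith [(n.cast_nonneg : (0 : ℝ) ≤ n)]
  have : 0 < (n : ℝ) + 2 + z := by linarith
  positivity

theorem tsum_ite_le_mul_ofReal {z : ℝ} (hz : -1 < z) (m : ℕ) (c : ENNReal) :
    ∑' n : ℕ, (if m ≤ n then c else 0) *
        ENNReal.ofReal (1 / (((n : ℝ) + 1 + z) * ((n : ℝ) + 2 + z))) =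
      c * ENNReal.ofReal (1 / ((m : ℝ) + 1 + z)) := by
  have htail := hasSum_ite_le_one_div_mul_succ hz m
  have hnonneg (n : ℕ) :
      0 ≤ if m ≤ n then 1 / (((n : ℝ) + 1 + z) * ((n : ℝ) + 2 + z)) else 0 := by
    split_ifs
    · exact one_div_mul_succ_nonneg hz n
    · exact le_rfl
  rw [← htail.tsum_eq, ENNReal.ofReal_tsum_of_nonneg hnonneg htail.summable,
    ← ENNReal.tsum_mul_left]
  refine tsum_congr fun n ↦ ?_
  split_ifs <;> simp

theorem prod_one_div_add_pow_nonneg {z : ℝ} (hz : -1 < z) {k : ℕ} (s f : Fin k → ℕ) :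
    0 ≤ ∏ i, 1 / ((f i : ℝ) + 1 + z) ^ s i := by
  refine Finset.prod_nonneg fun i _ ↦ ?_
  have : 0 < (f i : ℝ) + 1 + z := by linarith [((f i).cast_nonneg : (0 : ℝ) ≤ f i)]
  positivity

theorem finMZV_nonneg {z : ℝ} (hz : -1 < z) {k : ℕ} (s : Fin k → ℕ) (n : ℕ) :
    0 ≤ finMZV z s n := by
  refine Finset.sum_nonneg fun t _ ↦ ?_
  split_ifs
  · exact prod_one_div_add_pow_nonneg hz s fun i ↦ t i
  · exact le_rfl

theorem MZV_eq_toReal_tsum {z : ℝ} (hz : -1 < z) {k : ℕ} (s : Fin k → ℕ) :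
    MZV z s = (∑' f : {f : Fin k → ℕ // StrictMono f},
      ENNReal.ofReal (∏ i, 1 / ((f.1 i : ℝ) + 1 + z) ^ s i)).toReal :=
  Real.tsum_eq_toReal_tsum_ofReal
    fun f : {f : Fin k → ℕ // StrictMono f} ↦ prod_one_div_add_pow_nonneg hz s f.1

theorem ofReal_finMZV_succ {z : ℝ} (hz : -1 < z) {k : ℕ} (s : Fin (k + 1) → ℕ) (n : ℕ) :
    ENNReal.ofReal (finMZV z s (n + 1)) =
      ∑' f : {f : Fin (k + 1) → ℕ // StrictMono f}, if f.1 (Fin.last k) ≤ n then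
        ENNReal.ofReal (∏ i, 1 / ((f.1 i : ℝ) + 1 + z) ^ s i) else 0 := by
  let e : {t : Fin (k + 1) → Fin (n + 1) // StrictMono t} →
      {f : Fin (k + 1) → ℕ // StrictMono f} := fun t ↦ ⟨fun i ↦ t.1 i, fun _ _ h ↦ t.2 h⟩
  have he : Function.Injective e := fun t u h ↦
    Subtype.ext (funext fun i ↦ Fin.ext (congrFun (congrArg Subtype.val h) i))
  rw [← he.tsum_eq, tsum_fintype, finMZV, ← Finset.sum_filter,
    ENNReal.ofReal_sum_of_nonneg fun t _ ↦ prod_one_div_add_pow_nonneg hz s fun i ↦ t i,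
    Finset.sum_subtype (p := StrictMono) _ (by simp)]
  · refine Finset.sum_congr rfl fun t _ ↦ ?_
    rw [if_pos (Nat.lt_succ_iff.mp (t.1 (Fin.last k)).2)]
  · intro f hf
    have hle : f.1 (Fin.last k) ≤ n := by
      by_contra h
      exact hf (if_neg h)
    exact ⟨⟨fun i ↦ ⟨f.1 i, Nat.lt_succ_of_le ((f.2.monotone (Fin.le_last i)).trans hle)⟩,
      fun _ _ h ↦ f.2 h⟩, rfl⟩

theorem prod_one_div_pow_update_last {R : Type*} [Field R] {k : ℕ} (s : Fin (k + 1) → ℕ)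
    (x : Fin (k + 1) → R) :
    ∏ i, 1 / x i ^ Function.update s (Fin.last k) (s (Fin.last k) + 1) i =
      (∏ i, 1 / x i ^ s i) * (1 / x (Fin.last k)) := by
  simp only [Fin.prod_univ_castSucc, Function.update_self,
    Function.update_of_ne (Fin.castSucc_lt_last _).ne, pow_succ, mul_assoc, one_div_mul_one_div]

/-- Theorem 3.2: `∑_{n≥1} ζ_n(s_1,…,s_k;z)/((n+z)(n+1+z)) = ζ(s_1,…,s_{k-1},s_k+1;z)`. -/
theorem eta_one_one (z : ℝ) (hz : z ∈ Set.Ioc (-1 : ℝ) 0)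
    {k : ℕ} (s : Fin (k + 1) → ℕ) (hs : ∀ i, 0 < s i) :
    ∑' n : ℕ, finMZV z s (n + 1) / (((n : ℝ) + 1 + z) * ((n : ℝ) + 2 + z)) =
      MZV z (Function.update s (Fin.last k) (s (Fin.last k) + 1)) := by
  have hz' := hz.1
  simp only [div_eq_mul_one_div (finMZV z s _)]
  rw [MZV_eq_toReal_tsum hz', Real.tsum_eq_toReal_tsum_ofReal fun n : ℕ ↦
      mul_nonneg (finMZV_nonneg hz' s (n + 1)) (one_div_mul_succ_nonneg hz' n)]
  simp only [ENNReal.ofReal_mul (finMZV_nonneg hz' s _), ofReal_finMZV_succ hz',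
    ← ENNReal.tsum_mul_right]
  rw [ENNReal.tsum_comm]
  refine congrArg ENNReal.toReal (tsum_congr fun f ↦ ?_)
  rw [prod_one_div_pow_update_last s fun i ↦ (f.1 i : ℝ) + 1 + z,
    ENNReal.ofReal_mul (prod_one_div_add_pow_nonneg hz' s f.1), tsum_ite_le_mul_ofReal hz']
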